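/- For every c ∈ ℝ and every n ≥ 1, the hat tiling intersection identity φ·p_n = f_2^{(n+1)}(q_n) holds, i.e. φ·p_n = φe^{−iπ/3}·q_n + t_2^{(n+1)}, where p_n and q_n are the closed-form intersection points of the hat supertiles. -/

import Mathlib

open Filter Metric Topology

/-- `φ = (3 − √5)/2`, the inverse square of the golden ratio. -/
noncomputable def hatPhi : ℝ := (3 - Real.sqrt 5) / 2

/-- The Fibonacci numbers as real numbers (`F₀ = 0`, `F₁ = F₂ = 1`). -/
noncomputable def fibR (m : ℕ) : ℝ := (Nat.fib m : ℝ)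

/-- The translation vector `t_i⁽ⁿ⁾` of the `i`-th hat SIFS map at level `n`
(for `i ∈ {1,…,7}`; `t₁⁽ⁿ⁾ = 0`). -/
noncomputable def hatT (c : ℝ) (i n : ℕ) : ℂ :=
  match i with
  | 1 => 0
  | 2 => ((hatPhi ^ n * (Real.sqrt 3 * (1 - c) * (fibR (2 * n + 2) - 2)
            + 3 * c * (fibR (2 * n - 1) - 1)) : ℝ) : ℂ)
       + Complex.I * ((hatPhi ^ n * (3 * (1 - c) * fibR (2 * n - 1)
            + Real.sqrt 3 * c * (2 * fibR (2 * n + 1) + fibR (2 * n - 1) - 1)) : ℝ) : ℂ)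
  | 3 => ((hatPhi ^ n * (3 * Real.sqrt 3 * (1 - c) * (fibR (2 * n + 1) - 1)
            + 3 * c * (2 * fibR (2 * n - 1) + fibR (2 * n + 1) - 2)) : ℝ) : ℂ)
       + Complex.I * ((hatPhi ^ n * (-3 * (1 - c) * (fibR (2 * n - 2) - 1)
            + 3 * Real.sqrt 3 * c * fibR (2 * n + 1)) : ℝ) : ℂ)
  | 4 => ((hatPhi ^ n * (2 * Real.sqrt 3 * (1 - c) * fibR (2 * n + 1)
            + 3 * c * (2 * fibR (2 * n + 2) - 1)) : ℝ) : ℂ)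
       + Complex.I * ((hatPhi ^ n * (-6 * (1 - c) * (fibR (2 * n + 1) - 1)
            - Real.sqrt 3 * c * (2 * fibR (2 * n - 1) - 3)) : ℝ) : ℂ)
  | 5 => ((hatPhi ^ n * (Real.sqrt 3 * (1 - c) * (fibR (2 * n) + 1)
            + 9 * c * fibR (2 * n)) : ℝ) : ℂ)
       + Complex.I * ((hatPhi ^ n * (-3 * (1 - c) * (fibR (2 * n - 1) + fibR (2 * n + 1) - 1)
            + Real.sqrt 3 * c * (2 - fibR (2 * n - 1) - fibR (2 * n + 1))) : ℝ) : ℂ)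
  | 6 => ((hatPhi ^ n * (Real.sqrt 3 * (1 - c) + 3 * c)
            * (fibR (2 * n) + fibR (2 * n - 2)) : ℝ) : ℂ)
       + Complex.I * ((hatPhi ^ n * (-3 * (1 - c) + Real.sqrt 3 * c) * fibR (2 * n - 1) : ℝ) : ℂ)
  | 7 => ((hatPhi ^ n * (Real.sqrt 3 * (1 - c) + 3 * c)
            * (fibR (2 * n + 1) + fibR (2 * n - 1)) : ℝ) : ℂ)
       + Complex.I * ((hatPhi ^ n * (-3 * (1 - c) + Real.sqrt 3 * c) * fibR (2 * n) : ℝ) : ℂ)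
  | _ => 0

/-- The linear coefficient of the `i`-th hat SIFS map: `φ` times a sixth root of unity. -/
noncomputable def hatCoef (i : ℕ) : ℂ :=
  match i with
  | 1 => (hatPhi : ℂ)
  | 2 => (hatPhi : ℂ) * Complex.exp (-Complex.I * Real.pi / 3)
  | 3 => (hatPhi : ℂ) * Complex.exp (-2 * Complex.I * Real.pi / 3)
  | 4 => (hatPhi : ℂ) * Complex.exp (2 * Complex.I * Real.pi / 3)
  | 5 => (hatPhi : ℂ) * Complex.exp (Complex.I * Real.pi / 3)
  | 6 => (hatPhi : ℂ)
  | 7 => (hatPhi : ℂ)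
  | _ => 0

/-- The `i`-th hat SIFS map at level `n`: `f_i⁽ⁿ⁾(z) = hatCoef i · z + t_i⁽ⁿ⁾`. -/
noncomputable def hatF (c : ℝ) (i n : ℕ) (z : ℂ) : ℂ := hatCoef i * z + hatT c i n

/-- The hat tile vertex `v₈ = 2(1−c)√3 + c(3 + 3√3 i)`. -/
noncomputable def hatV8 (c : ℝ) : ℂ :=
  ((2 * (1 - c) * Real.sqrt 3 : ℝ) : ℂ) + (c : ℂ) * (3 + 3 * (Real.sqrt 3 : ℂ) * Complex.I)

/-- The closed-form intersection point
`p_n = φⁿ[ v₈ + (√3(1−c)+3c)(F_{2n+2}+F_{2n}−1) + i(−3(1−c)+√3c)(F_{2n+1}−1) ]`. -/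
noncomputable def hatP (c : ℝ) (n : ℕ) : ℂ :=
  ((hatPhi ^ n : ℝ) : ℂ) * (hatV8 c
    + (((Real.sqrt 3 * (1 - c) + 3 * c) * (fibR (2 * n + 2) + fibR (2 * n) - 1) : ℝ) : ℂ)
    + Complex.I * (((-3 * (1 - c) + Real.sqrt 3 * c) * (fibR (2 * n + 1) - 1) : ℝ) : ℂ))

/-- The closed-form intersection point
`q_n = φⁿ[ 2√3(1−c)F_{2n+1}+3c(2F_{2n+2}−1) + i(−6(1−c)(F_{2n+1}−1)−√3c(2F_{2n−1}−3)) ]`. -/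
noncomputable def hatQ (c : ℝ) (n : ℕ) : ℂ :=
  ((hatPhi ^ n : ℝ) : ℂ) *
    (((2 * Real.sqrt 3 * (1 - c) * fibR (2 * n + 1) + 3 * c * (2 * fibR (2 * n + 2) - 1) : ℝ) : ℂ)
    + Complex.I * (((-6 * (1 - c) * (fibR (2 * n + 1) - 1)
        - Real.sqrt 3 * c * (2 * fibR (2 * n - 1) - 3)) : ℝ) : ℂ))

lemma fibR_add_two (m : ℕ) : fibR (m + 2) = fibR m + fibR (m + 1) := by
  simp [fibR, Nat.fib_add_two]

lemma exp_neg_I_mul_pi_div_three :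
    Complex.exp (-Complex.I * Real.pi / 3) = 1 / 2 - (Real.sqrt 3 : ℂ) / 2 * Complex.I := by
  have h : -Complex.I * Real.pi / 3 = ((-(Real.pi / 3) : ℝ) : ℂ) * Complex.I := by
    push_cast
    ring
  rw [h, Complex.exp_mul_I, ← Complex.ofReal_cos, ← Complex.ofReal_sin, Real.cos_neg,
    Real.sin_neg, Real.cos_pi_div_three, Real.sin_pi_div_three]
  push_cast
  ring

/-- For every `c ∈ ℝ` and `n ≥ 1`, `φ·p_n = f₂⁽ⁿ⁺¹⁾(q_n)`, i.e.
`φ·p_n = φe^{−iπ/3}·q_n + t₂⁽ⁿ⁺¹⁾`. -/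
theorem hat_intersection_p_eq_f2_q (c : ℝ) (n : ℕ) (hn : 1 ≤ n) :
    (hatPhi : ℂ) * hatP c n = hatF c 2 (n + 1) (hatQ c n) := by
  obtain ⟨m, rfl⟩ : ∃ m, n = m + 1 := ⟨n - 1, by lia⟩
  have h3 : (Real.sqrt 3 : ℂ) ^ 2 = 3 := by
    exact_mod_cast Real.sq_sqrt (show (0 : ℝ) ≤ 3 by norm_num)
  have e1 : 2 * (m + 1) - 1 = 2 * m + 1 := by lia
  have e2 : 2 * (m + 1 + 1) - 1 = 2 * m + 3 := by lia
  simp only [hatF, hatP, hatQ, hatV8, hatT, hatCoef, exp_neg_I_mul_pi_div_three, e1, e2]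
  simp only [mul_add, mul_one, add_assoc, Nat.reduceAdd]
  have f3 : fibR (2 * m + 3) = fibR (2 * m + 1) + fibR (2 * m + 2) := fibR_add_two (2 * m + 1)
  have f4 : fibR (2 * m + 4) = fibR (2 * m + 2) + fibR (2 * m + 3) := fibR_add_two (2 * m + 2)
  have f5 : fibR (2 * m + 5) = fibR (2 * m + 3) + fibR (2 * m + 4) := fibR_add_two (2 * m + 3)
  have f6 : fibR (2 * m + 6) = fibR (2 * m + 4) + fibR (2 * m + 5) := fibR_add_two (2 * m + 4)
  simp only [f6, f5, f4, f3]
  push_cast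
  generalize (fibR (2 * m + 1) : ℂ) = a
  generalize (fibR (2 * m + 2) : ℂ) = b
  generalize (Real.sqrt 3 : ℂ) = s at *
  generalize (hatPhi : ℂ) = x
  generalize (c : ℂ) = c
  linear_combination
    x ^ (m + 2) * (s / 2 * (-6 * (1 - c) * (a + b - 1) - s * c * (2 * a - 3))) * Complex.I_sq
      + x ^ (m + 2) * (Complex.I * (1 - c) * (a + b) + c * (2 * a - 3) / 2) * h3
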